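/- Let G = (X,E) be a finite connected graph without dead ends such that c(G) ≠ 1 or G is not 2-colorable. Then every f ∈ E_{−1}(Δᵉ; Maps(E,ℂ)) satisfies f(e) = f(ē) for every edge e ∈ E and Σ_{e ∈ E, ι(e) = x} f(e) = 0 for every vertex x ∈ X. -/

import Mathlib

open Function Set
open scoped Classical

namespace GraphQCC

variable {X : Type} (G : SimpleGraph X)

/-- The set of directed edges of a (symmetric, loopless) graph. -/
abbrev DE := {p : X × X // G.Adj p.1 p.2}

variable {G}

/-- Initial vertex of a directed edge. -/
def ini (e : DE G) : X := e.1.1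

/-- Terminal vertex of a directed edge. -/
def ter (e : DE G) : X := e.1.2

/-- Opposite edge. -/
def op (e : DE G) : DE G := ⟨(e.1.2, e.1.1), e.2.symm⟩

variable (G)

/-- Degree of a vertex: the number of directed edges starting at it. -/
noncomputable def deg (x : X) : ℕ := Set.ncard {e : DE G | ini e = x}

/-- The graph is locally finite: every vertex has finite degree. -/
def LocFin : Prop := ∀ x : X, {e : DE G | ini e = x}.Finite

/-- The edge Laplacian. -/
noncomputable def edgeLap (f : DE G → ℂ) (e : DE G) : ℂ :=
  ∑ᶠ e' ∈ {e' : DE G | ini e' = ter e ∧ e' ≠ op e}, f e'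

/-- The `z`-eigenspace of the edge Laplacian, as a set of functions on directed edges. -/
def edgeEig (z : ℂ) : Set (DE G → ℂ) := {f | ∀ e, edgeLap G f e = z * f e}

/-- The edge inversion operator Ξ. -/
def Xi (f : DE G → ℂ) (e : DE G) : ℂ := f (op e)

/-- The operator Σ (sum over edges with the same initial point). -/
noncomputable def Sig (f : DE G → ℂ) (e : DE G) : ℂ :=
  ∑ᶠ e' ∈ {e' : DE G | ini e' = ini e}, f e'

/-- Edges pointing away from a vertex `o`. -/
def away (o : X) : Set (DE G) := {e | G.dist o (ter e) = G.dist o (ini e) + 1}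

/-- The edge Laplacian on functions on the edges pointing away from `o`. -/
noncomputable def edgeLapAway (o : X) (f : ↥(away G o) → ℂ) (e : ↥(away G o)) : ℂ :=
  ∑ᶠ e' ∈ {e' : ↥(away G o) | ini e'.1 = ter e.1 ∧ e'.1 ≠ op e.1}, f e'

/-- The `z`-eigenspace of the edge Laplacian on edges pointing away from `o`. -/
def edgeEigAway (o : X) (z : ℂ) : Set (↥(away G o) → ℂ) :=
  {f | ∀ e, edgeLapAway G o f e = z * f e}

/-! ## Boundary at infinity -/

/-- A ray: an infinite non-backtracking chain of vertices. -/
def IsRay (r : ℕ → X) : Prop := (∀ n, G.Adj (r n) (r (n + 1))) ∧ ∀ n, r (n + 2) ≠ r n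

abbrev Ray := {r : ℕ → X // IsRay G r}

/-- Two rays are equivalent if they share infinitely many vertices. -/
def RayRel (r r' : Ray G) : Prop := (Set.range r.1 ∩ Set.range r'.1).Infinite

/-- The boundary at infinity: equivalence classes of rays. -/
def Boundary := Quot (RayRel G)

/-- The set `∂₊ e` of boundary points reachable by a non-backtracking chain starting with `e`. -/
def plusBd (e : DE G) : Set (Boundary G) :=
  {ω | ∃ r : Ray G, Quot.mk (RayRel G) r = ω ∧ r.1 0 = ini e ∧ r.1 1 = ter e}

/-- The topology on the boundary generated by the sets `∂₊ e`. -/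
instance : TopologicalSpace (Boundary G) :=
  TopologicalSpace.generateFrom {s | ∃ e : DE G, s = plusBd G e}

/-- The space of locally constant functions on the boundary. -/
noncomputable def Clc : Submodule ℂ (Boundary G → ℂ) where
  carrier := {f | IsLocallyConstant f}
  add_mem' hf hg := hf.comp₂ hg (· + ·)
  zero_mem' := IsLocallyConstant.const 0
  smul_mem' c f hf := hf.comp (c * ·)

/-- `D'(Ω)`: the algebraic dual of the space of locally constant functions on the boundary. -/
abbrev DualB := Module.Dual ℂ ↥(Clc G)

/-- Pairing of a functional on `C^lc(Ω)` with a function on the boundary. -/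
noncomputable def pairB (μ : DualB G) (g : Boundary G → ℂ) : ℂ :=
  if h : IsLocallyConstant g then μ ⟨g, h⟩ else 0

/-- The horocycle bracket `⟨x, ω⟩` with respect to the base point `o`: the unique integer `k`
such that `d(x, r n) = n - k` for every ray `r` from `o` representing `ω` and all large `n`. -/
noncomputable def horo (o x : X) (ω : Boundary G) : ℤ :=
  if h : ∃ k : ℤ, ∀ r : Ray G, Quot.mk (RayRel G) r = ω → r.1 0 = o →
      ∃ N : ℕ, ∀ n : ℕ, N ≤ n → (G.dist x (r.1 n) : ℤ) = (n : ℤ) - k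
  then h.choose else 0

/-- The scalar Poisson transform. -/
noncomputable def poisson (o : X) (z : ℂ) (μ : DualB G) (x : X) : ℂ :=
  pairB G μ fun ω => z ^ horo G o x ω

/-- The edge Poisson transform. -/
noncomputable def edgePoisson (o : X) (z : ℂ) (μ : DualB G) (e : DE G) : ℂ :=
  pairB G μ fun ω => z ^ horo G o (ini e) ω * Set.indicator (plusBd G e) 1 ω

/-! ## The shift space of non-backtracking chains of edges -/

/-- An infinite concatenated non-backtracking sequence of directed edges. -/
def IsChainSeq (c : ℕ → DE G) : Prop :=
  ∀ i, ter (c i) = ini (c (i + 1)) ∧ ter (c (i + 1)) ≠ ini (c i)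

/-- The shift space `𝔓`. -/
abbrev ChainSp := {c : ℕ → DE G // IsChainSeq G c}

/-- The one-sided shift on chains. -/
def shift (c : ChainSp G) : ChainSp G := ⟨fun n => c.1 (n + 1), fun i => c.2 (i + 1)⟩

/-- The district (cylinder) topology on the shift space. -/
instance : TopologicalSpace (ChainSp G) :=
  TopologicalSpace.generateFrom
    {s | ∃ (c₀ : ChainSp G) (n : ℕ), s = {c : ChainSp G | ∀ i ≤ n, c.1 i = c₀.1 i}}

/-- The Ruelle transfer operator. -/
noncomputable def transfer (F : ChainSp G → ℂ) (c : ChainSp G) : ℂ :=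
  ∑ᶠ c' ∈ {c' : ChainSp G | shift G c' = c}, F c'

/-- Functions on chains depending only on the first `N` edges. -/
def cylFun (N : ℕ) : Set (ChainSp G → ℂ) :=
  {F | ∀ c c' : ChainSp G, (∀ i < N, c.1 i = c'.1 i) → F c = F c'}

/-- The ray of initial vertices of a chain of edges. -/
def toRay (c : ChainSp G) : Ray G :=
  ⟨fun n => ini (c.1 n), by
    refine ⟨fun n => ?_, fun n => ?_⟩
    · have h1 : ter (c.1 n) = ini (c.1 (n + 1)) := (c.2 n).1
      have h2 : G.Adj (ini (c.1 n)) (ter (c.1 n)) := (c.1 n).2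
      rwa [h1] at h2
    · have h1 : ter (c.1 (n + 1)) = ini (c.1 (n + 2)) := (c.2 (n + 1)).1
      have h2 : ter (c.1 (n + 1)) ≠ ini (c.1 n) := (c.2 n).2
      rwa [h1] at h2⟩

/-- The endpoint map `B : 𝔓 → Ω`. -/
def endB (c : ChainSp G) : Boundary G := Quot.mk (RayRel G) (toRay G c)

/-- The pushforward `B_⋆` by fiber summation. -/
noncomputable def push (f : ChainSp G → ℂ) (ω : Boundary G) : ℂ :=
  ∑ᶠ c ∈ {c : ChainSp G | endB G c = ω}, f c

/-- The space of locally constant compactly supported functions on the shift space. -/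
noncomputable def CcP : Submodule ℂ (ChainSp G → ℂ) where
  carrier := {F | IsLocallyConstant F ∧ HasCompactSupport F}
  add_mem' hf hg := ⟨hf.1.comp₂ hg.1 (· + ·), hf.2.add hg.2⟩
  zero_mem' := ⟨IsLocallyConstant.const 0, HasCompactSupport.zero⟩
  smul_mem' c f hf := ⟨hf.1.comp (c * ·),
    hf.2.mono fun x hx h0 => hx (by simp [h0])⟩

/-- `D'(𝔓)`: the algebraic dual of `C^lc_c(𝔓)`. -/
abbrev DualP := Module.Dual ℂ ↥(CcP G)

/-- Pairing of a functional on `C^lc_c(𝔓)` with a function on the shift space. -/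
noncomputable def pairP (lam : DualP G) (g : ChainSp G → ℂ) : ℂ :=
  if h : g ∈ CcP G then lam ⟨g, h⟩ else 0

/-- The space of locally constant functions on the shift space (for finite graphs this is
`C^lc_c(𝔓)` since `𝔓` is compact). -/
noncomputable def ClcP : Submodule ℂ (ChainSp G → ℂ) where
  carrier := {F | IsLocallyConstant F}
  add_mem' hf hg := hf.comp₂ hg (· + ·)
  zero_mem' := IsLocallyConstant.const 0
  smul_mem' c f hf := hf.comp (c * ·)

/-- The dual of `C^lc(𝔓)`. -/
abbrev DualPc := Module.Dual ℂ ↥(ClcP G)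

/-- Pairing of a functional on `C^lc(𝔓)` with a function on the shift space. -/
noncomputable def pairPc (lam : DualPc G) (g : ChainSp G → ℂ) : ℂ :=
  if h : IsLocallyConstant g then lam ⟨g, h⟩ else 0

/-! ## Vertex Laplacian -/

/-- The vertex Laplacian (averaging over neighbors). -/
noncomputable def vertexLap (f : X → ℂ) (x : X) : ℂ :=
  ((deg G x : ℂ))⁻¹ * ∑ᶠ e ∈ {e : DE G | ini e = x}, f (ter e)

/-- The function `χ(z)(x) = (z + q_x z⁻¹)/(q_x + 1)`. -/
noncomputable def chi (z : ℂ) (x : X) : ℂ :=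
  (z + ((deg G x : ℂ) - 1) * z⁻¹) / (deg G x : ℂ)

/-- The `χ(z)`-eigenspace of the vertex Laplacian. -/
def vertexEig (z : ℂ) : Set (X → ℂ) := {f | ∀ x, vertexLap G f x = chi G z x * f x}

/-! ## Miscellaneous -/

/-- Two subsets of complex vector spaces (in practice: subspaces) are linearly isomorphic. -/
def AreLinIso {M N : Type} [AddCommMonoid M] [Module ℂ M] [AddCommMonoid N] [Module ℂ N]
    (A : Set M) (B : Set N) : Prop :=
  ∃ F : M → N, Set.BijOn F A B ∧ (∀ a ∈ A, ∀ b ∈ A, F (a + b) = F a + F b) ∧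
    ∀ (c : ℂ), ∀ a ∈ A, F (c • a) = c • F a

/-- The `z`-eigenspace of the edge Laplacian as a submodule (for a locally finite graph). -/
noncomputable def edgeEigSub (hlf : LocFin G) (z : ℂ) : Submodule ℂ (DE G → ℂ) where
  carrier := edgeEig G z
  add_mem' := by
    intro f g hf hg e
    have hS : {e' : DE G | ini e' = ter e ∧ e' ≠ op e}.Finite :=
      (hlf (ter e)).subset fun _ h => h.1
    have : edgeLap G (f + g) e = edgeLap G f e + edgeLap G g e := by
      simpa [edgeLap] using finsum_mem_add_distrib (f := f) (g := g) hS
    rw [this, hf e, hg e, Pi.add_apply, mul_add]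
  zero_mem' := by
    intro e
    simp [edgeLap]
  smul_mem' := by
    intro c f hf e
    have hS : {e' : DE G | ini e' = ter e ∧ e' ≠ op e}.Finite :=
      (hlf (ter e)).subset fun _ h => h.1
    have : edgeLap G (c • f) e = c * edgeLap G f e := by
      simp only [edgeLap, Pi.smul_apply, smul_eq_mul]
      rw [finsum_mem_eq_finite_toFinset_sum _ hS, finsum_mem_eq_finite_toFinset_sum _ hS,
        Finset.mul_sum]
    rw [Pi.smul_apply, smul_eq_mul, this, hf e]; ring

/-- The cyclomatic number of a finite graph, as an integer. -/
noncomputable def cyclo : ℤ := (Nat.card G.edgeSet : ℤ) - (Nat.card X : ℤ) + 1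

/-- 2-colorability. -/
def TwoColorable : Prop := ∃ col : X → Bool, ∀ x y : X, G.Adj x y → col x ≠ col y

variable {G}

@[simp] theorem op_op (e : DE G) : op (op e) = e := rfl

@[simp] theorem ini_op (e : DE G) : ini (op e) = ter e := rfl

/-- The inversion of directed edges as a permutation. -/
def opEquiv : Equiv.Perm (DE G) := ⟨op, op, op_op, op_op⟩

/-- Directed edges are the darts of the graph. -/
def dartEquiv : G.Dart ≃ DE G where
  toFun d := ⟨d.toProd, d.adj⟩
  invFun e := ⟨e.1, e.2⟩
  left_inv _ := rfl
  right_inv _ := rfl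

/-- The sum of `f` over the directed edges starting at `x`. -/
noncomputable def outSum (f : DE G → ℂ) (x : X) : ℂ := ∑ᶠ e ∈ {e : DE G | ini e = x}, f e

theorem nat_card_directed_edges [Finite X] : Nat.card (DE G) = 2 * Nat.card G.edgeSet := by
  have := Fintype.ofFinite X
  rw [← Nat.card_congr dartEquiv, Nat.card_eq_fintype_card, Nat.card_eq_fintype_card,
    G.dart_card_eq_twice_card_edges, SimpleGraph.edgeFinset_card]

theorem outSum_eq_sum [Fintype X] (f : DE G → ℂ) (x : X) :
    outSum f x = ∑ e with ini e = x, f e := by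
  rw [outSum, finsum_mem_eq_finite_toFinset_sum _ (Set.toFinite _)]
  congr 1
  ext e
  simp

theorem outSum_ter_eq_edgeLap_add [Finite X] (f : DE G → ℂ) (e : DE G) :
    outSum f (ter e) = edgeLap G f e + f (op e) := by
  have hset : {e' : DE G | ini e' = ter e} =
      insert (op e) {e' : DE G | ini e' = ter e ∧ e' ≠ op e} := by
    ext e'
    by_cases h : e' = op e <;> simp [h]
  rw [outSum, hset, finsum_mem_insert _ (by simp) (Set.toFinite _), edgeLap, add_comm]

theorem outSum_ter_of_mem_edgeEig [Finite X] {f : DE G → ℂ} (hf : f ∈ edgeEig G (-1))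
    (e : DE G) : outSum f (ter e) = f (op e) - f e := by
  rw [outSum_ter_eq_edgeLap_add, hf e]
  ring

theorem outSum_ini_of_mem_edgeEig [Finite X] {f : DE G → ℂ} (hf : f ∈ edgeEig G (-1))
    (e : DE G) : outSum f (ini e) = f e - f (op e) :=
  outSum_ter_of_mem_edgeEig hf (op e)

theorem outSum_eq_neg_of_adj [Finite X] {f : DE G → ℂ} (hf : f ∈ edgeEig G (-1)) {x y : X}
    (h : G.Adj x y) : outSum f y = -outSum f x := by
  have h₁ := outSum_ter_of_mem_edgeEig hf ⟨(x, y), h⟩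
  have h₂ := outSum_ini_of_mem_edgeEig hf ⟨(x, y), h⟩
  simp only [ini, ter] at h₁ h₂
  rw [h₁, h₂, neg_sub]

theorem sq_outSum_eq [Finite X] (hconn : G.Connected) {f : DE G → ℂ}
    (hf : f ∈ edgeEig G (-1)) (x y : X) : outSum f x ^ 2 = outSum f y ^ 2 := by
  obtain ⟨w⟩ := hconn.preconnected x y
  induction w with
  | nil => rfl
  | cons h _ ih => rw [← ih, outSum_eq_neg_of_adj hf h, neg_sq]

theorem twoColorable_of_outSum_ne_zero [Finite X] (hconn : G.Connected) {f : DE G → ℂ}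
    (hf : f ∈ edgeEig G (-1)) {x₀ : X} (h₀ : outSum f x₀ ≠ 0) : TwoColorable G := by
  refine ⟨fun x => decide (outSum f x = outSum f x₀), fun x y h => ?_⟩
  have hneg := outSum_eq_neg_of_adj hf h
  rcases sq_eq_sq_iff_eq_or_eq_neg.mp (sq_outSum_eq hconn hf x x₀) with hx | hx <;>
    simp [hneg, hx, neg_eq_self, h₀]

theorem sum_sq_outSum [Fintype X] {f : DE G → ℂ} (hf : f ∈ edgeEig G (-1)) :
    2 * ∑ x, outSum f x ^ 2 = ∑ e : DE G, outSum f (ini e) ^ 2 := by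
  have h₁ : ∑ x, outSum f x ^ 2 = ∑ e : DE G, outSum f (ini e) * f e := by
    rw [← Finset.sum_fiberwise Finset.univ ini]
    refine Finset.sum_congr rfl fun x _ => ?_
    rw [sq]
    nth_rewrite 2 [outSum_eq_sum]
    rw [Finset.mul_sum]
    exact Finset.sum_congr rfl fun e he => by rw [(Finset.mem_filter.mp he).2]
  have h₂ : ∑ x, outSum f x ^ 2 = -∑ e : DE G, outSum f (ini e) * f (op e) := by
    rw [h₁, ← Equiv.sum_comp opEquiv, ← Finset.sum_neg_distrib]
    refine Finset.sum_congr rfl fun e _ => ?_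
    change outSum f (ter e) * f (op e) = _
    rw [show outSum f (ter e) = -outSum f (ini e) from outSum_eq_neg_of_adj hf e.2]
    exact neg_mul _ _
  rw [two_mul]
  nth_rewrite 1 [h₁]
  rw [h₂, ← sub_eq_add_neg, ← Finset.sum_sub_distrib]
  refine Finset.sum_congr rfl fun e _ => ?_
  rw [← mul_sub, ← outSum_ini_of_mem_edgeEig hf, sq]

theorem cyclo_eq_one_of_outSum_ne_zero [Finite X] (hconn : G.Connected) {f : DE G → ℂ}
    (hf : f ∈ edgeEig G (-1)) {x₀ : X} (h₀ : outSum f x₀ ≠ 0) : cyclo G = 1 := by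
  have := Fintype.ofFinite X
  have h := sum_sq_outSum hf
  simp only [fun x => sq_outSum_eq hconn hf x x₀, Finset.sum_const, Finset.card_univ,
    nsmul_eq_mul, ← Nat.card_eq_fintype_card, nat_card_directed_edges] at h
  rw [← mul_assoc, mul_left_inj' (pow_ne_zero 2 h₀)] at h
  have hcard : 2 * Nat.card X = 2 * Nat.card G.edgeSet := by exact_mod_cast h
  rw [cyclo]
  lia

/-- If `c(G) ≠ 1` or `G` is not 2-colorable, every `(-1)`-eigenfunction
of the edge Laplacian is invariant under edge inversion and sums to zero over the edges
leaving any vertex. -/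
theorem statement17 {X : Type} [Finite X] (G : SimpleGraph X) (hconn : G.Connected)
    (hnd : ∀ x : X, 2 ≤ deg G x) (hc : cyclo G ≠ 1 ∨ ¬ TwoColorable G) :
    ∀ f ∈ edgeEig G (-1), (∀ e : DE G, f e = f (op e)) ∧
      ∀ x : X, ∑ᶠ e ∈ {e : DE G | ini e = x}, f e = 0 := by
  intro f hf
  have hzero : ∀ x, outSum f x = 0 := fun x => by
    by_contra h
    exact hc.elim (fun hne => hne (cyclo_eq_one_of_outSum_ne_zero hconn hf h))
      fun hcol => hcol (twoColorable_of_outSum_ne_zero hconn hf h)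
  exact ⟨fun e => sub_eq_zero.mp ((outSum_ini_of_mem_edgeEig hf e).symm.trans (hzero _)), hzero⟩

end GraphQCC
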